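/- arXiv:2405.02419 — 2 statements merged into one kernel-verified Lean document; each statement's English description precedes it below -/
import Mathlib

section
/- Let V be a vector space over a field K and let v_1, …, v_n be linearly independent vectors in V. Then for any vector w ∈ V and any scalars r_1, …, r_n ∈ K, the subspace of V spanned by {v_1 − r_1·w, …, v_n − r_n·w} has dimension at least n − 1. -/
/-- Let `V` be a vector space over a field `K` and let `v 0, …, v (n-1)` be
linearly independent vectors in `V`. Then for any vector `w ∈ V` and any scalars
`r 0, …, r (n-1) ∈ K`, the subspace of `V` spanned by `{v i − r i • w : i}` has
dimension at least `n − 1`. -/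
theorem span_sub_smul_rank_ge {K V : Type*} [Field K] [AddCommGroup V] [Module K V]
    (n : ℕ) (v : Fin n → V) (hv : LinearIndependent K v) (w : V) (r : Fin n → K) :
    ((n - 1 : ℕ) : Cardinal) ≤
      Module.rank K ↥(Submodule.span K (Set.range fun i => v i - r i • w)) := by
  set S := Submodule.span K (Set.range fun i => v i - r i • w)
  have : FiniteDimensional K S := FiniteDimensional.span_of_finite K (Set.finite_range _)
  have hle : Submodule.span K (Set.range v) ≤ S ⊔ Submodule.span K {w} := by
    rw [Submodule.span_le]
    rintro _ ⟨i, rfl⟩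
    rw [← sub_add_cancel (v i) (r i • w)]
    exact Submodule.add_mem_sup (Submodule.subset_span ⟨i, rfl⟩)
      (Submodule.smul_mem _ _ (Submodule.mem_span_singleton_self w))
  have hn : Module.finrank K (Submodule.span K (Set.range v)) = n := by
    simpa using finrank_span_eq_card hv
  have hw := finrank_span_le_card (R := K) ({w} : Set V)
  have hmono := Submodule.finrank_mono hle
  have hadd := Submodule.finrank_add_le_finrank_add_finrank S (Submodule.span K {w})
  rw [← Module.finrank_eq_rank, Nat.cast_le]
  simp only [Set.toFinset_singleton, Finset.card_singleton] at hw
  omega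
end

section
/- Let n ≥ 5 and N ≥ 1 be integers, k ≥ 5 a real number, t a rational number with 0 ≤ t ≤ k/2 − 2, and d a positive real number with log d ≥ 2n log n − 2 log(n!). Then −log(N d²) + 2n log(2π) − n ψ(k/2 + t) − n ψ(k/2 − t) < 0. -/
open Real

/-- The real digamma function `ψ = Γ'/Γ`, the logarithmic derivative of the real Gamma
function. -/
noncomputable def realDigamma (x : ℝ) : ℝ := deriv Real.Gamma x / Real.Gamma x

lemma differentiableAt_realGamma_of_pos {x : ℝ} (hx : 0 < x) :
    DifferentiableAt ℝ Real.Gamma x :=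
  Real.differentiableAt_Gamma fun m ↦ ((neg_nonpos.mpr m.cast_nonneg).trans_lt hx).ne'

lemma deriv_log_comp_realGamma {x : ℝ} (hx : 0 < x) :
    deriv (Real.log ∘ Real.Gamma) x = realDigamma x :=
  deriv.log (differentiableAt_realGamma_of_pos hx) (Real.Gamma_pos_of_pos hx).ne'

lemma monotoneOn_realDigamma : MonotoneOn realDigamma (Set.Ioi 0) := by
  have h := Real.convexOn_log_Gamma.monotoneOn_deriv fun x hx ↦
    (differentiableAt_realGamma_of_pos hx).log (Real.Gamma_pos_of_pos hx).ne'
  exact h.congr fun x hx ↦ deriv_log_comp_realGamma hx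

lemma realDigamma_add_one {x : ℝ} (hx : 0 < x) :
    realDigamma (x + 1) = realDigamma x + 1 / x := by
  have hG := (Real.Gamma_pos_of_pos hx).ne'
  have h : deriv Real.Gamma (x + 1) = Real.Gamma x + x * deriv Real.Gamma x := by
    rw [← deriv_comp_add_const]
    have he : (fun y : ℝ ↦ Real.Gamma (y + 1)) =ᶠ[nhds x] fun y ↦ y * Real.Gamma y := by
      filter_upwards [eventually_ne_nhds hx.ne'] with y hy using Real.Gamma_add_one hy
    rw [he.deriv_eq]
    simpa using
      ((hasDerivAt_id' x).fun_mul (differentiableAt_realGamma_of_pos hx).hasDerivAt).deriv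
  rw [realDigamma, realDigamma, h, Real.Gamma_add_one hx.ne']
  field_simp
  ring

lemma realDigamma_one : realDigamma 1 = -Real.eulerMascheroniConstant := by
  rw [realDigamma, Real.hasDerivAt_Gamma_one.deriv, Real.Gamma_one, div_one]

lemma realDigamma_one_half :
    realDigamma (1 / 2) = -(Real.eulerMascheroniConstant + 2 * Real.log 2) := by
  have h : √π ≠ 0 := (Real.sqrt_pos.mpr Real.pi_pos).ne'
  rw [realDigamma, Real.hasDerivAt_Gamma_one_half.deriv, Real.Gamma_one_half_eq]
  field_simp

lemma realDigamma_two : realDigamma 2 = 1 - Real.eulerMascheroniConstant := by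
  have h := realDigamma_add_one (x := 1) one_pos
  rw [realDigamma_one] at h
  norm_num at h
  linarith

lemma realDigamma_five_halves :
    realDigamma (5 / 2) = 8 / 3 - Real.eulerMascheroniConstant - 2 * Real.log 2 := by
  have h₁ := realDigamma_add_one (x := 1 / 2) (by norm_num)
  have h₂ := realDigamma_add_one (x := 3 / 2) (by norm_num)
  rw [realDigamma_one_half] at h₁
  norm_num at h₁ h₂
  linarith

lemma eulerMascheroniConstant_lt_d3 : Real.eulerMascheroniConstant < 0.586 := by
  have h := Real.eulerMascheroniConstant_lt_eulerMascheroniSeq' (2 ^ 6)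
  have hH : (harmonic (2 ^ 6) : ℝ) < 4.744 := by
    norm_num [harmonic, Finset.sum_range_succ]
  rw [Real.eulerMascheroniSeq', if_neg (by norm_num), Nat.cast_pow, Real.log_pow] at h
  have := Real.log_two_gt_d9
  push_cast at h
  linarith

lemma log_two_mul_pi_lt : Real.log (2 * π) < 1.85 := by
  have hpi : 2 * π < 6.2832 := by linarith [Real.pi_lt_d4]
  have h : Real.log ((2 * π) ^ 20) < 37 := by
    rw [Real.log_lt_iff_lt_exp (by positivity)]
    calc (2 * π) ^ 20 < 6.2832 ^ 20 := by gcongr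
      _ < 2.7182818283 ^ 37 := by norm_num
      _ < Real.exp 1 ^ 37 := by gcongr; exact Real.exp_one_gt_d9
      _ = Real.exp 37 := by rw [← Real.exp_nat_mul]; norm_num
  rw [Real.log_pow] at h
  push_cast at h
  linarith

lemma log_factorial_le_of_five_le {n : ℕ} (hn : 5 ≤ n) :
    Real.log n.factorial ≤ n * Real.log n - 0.65 * n := by
  induction n, hn using Nat.le_induction with
  | base =>
    have h : (13 / 4 : ℝ) ≤ Real.log (5 ^ 5 / 120) := by
      have h4 : (13 : ℝ) ≤ Real.log ((5 ^ 5 / 120) ^ 4) := by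
        rw [Real.le_log_iff_exp_le (by positivity)]
        calc Real.exp 13 = Real.exp 1 ^ 13 := by rw [← Real.exp_nat_mul]; norm_num
          _ ≤ 2.7182818286 ^ 13 := by gcongr; exact Real.exp_one_lt_d9.le
          _ ≤ (5 ^ 5 / 120) ^ 4 := by norm_num
      rw [Real.log_pow] at h4
      push_cast at h4
      linarith
    rw [Real.log_div (by norm_num) (by norm_num), Real.log_pow] at h
    norm_num [Nat.factorial] at h ⊢
    linarith
  | succ n hn ih =>
    have hn' : (5 : ℝ) ≤ n := by exact_mod_cast hn
    have hn0 : (0 : ℝ) < n := by linarith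
    have hlog := Real.one_sub_inv_le_log_of_pos (x := ((n : ℝ) + 1) / n) (by positivity)
    rw [Real.log_div (by positivity) hn0.ne', inv_div] at hlog
    have hstep : 0.65 ≤ n * (Real.log (n + 1) - Real.log n) := by
      calc (0.65 : ℝ) ≤ n * (1 - n / (n + 1)) := by
            have : (n : ℝ) * (1 - n / (n + 1)) = n / (n + 1) := by field_simp; ring
            rw [this, le_div_iff₀ (by positivity)]
            linarith
        _ ≤ _ := by gcongr
    rw [Nat.factorial_succ, Nat.cast_mul,
      Real.log_mul (by positivity) (by exact_mod_cast n.factorial_ne_zero)]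
    push_cast
    linarith

/-- the key negativity estimate for Hilbert modular `L`-functions: for
`n ≥ 5`, `N ≥ 1`, `k ≥ 5`, `0 ≤ t ≤ k/2 − 2` rational, and `d > 0` with
`log d ≥ 2n log n − 2 log(n!)` (Minkowski's bound),
`−log(N d²) + 2n log(2π) − n ψ(k/2 + t) − n ψ(k/2 − t) < 0`. -/
theorem hilbert_negativity (n N : ℕ) (hn : 5 ≤ n) (hN : 1 ≤ N)
    (k : ℝ) (hk : 5 ≤ k) (t : ℚ) (ht : 0 ≤ t) (ht' : (t : ℝ) ≤ k / 2 - 2)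
    (d : ℝ) (hd : 0 < d)
    (hmink : Real.log d ≥ 2 * n * Real.log n - 2 * Real.log (Nat.factorial n)) :
    -Real.log ((N : ℝ) * d ^ 2) + 2 * n * Real.log (2 * π)
      - n * realDigamma (k / 2 + (t : ℝ)) - n * realDigamma (k / 2 - (t : ℝ)) < 0 := by
  have hn0 : (0 : ℝ) < n := by exact_mod_cast (by omega : 0 < n)
  have ht0 : (0 : ℝ) ≤ t := by exact_mod_cast ht
  have hψ₁ : realDigamma (5 / 2) ≤ realDigamma (k / 2 + t) :=
    monotoneOn_realDigamma (Set.mem_Ioi.mpr (by norm_num)) (Set.mem_Ioi.mpr (by linarith))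
      (by linarith)
  have hψ₂ : realDigamma 2 ≤ realDigamma (k / 2 - t) :=
    monotoneOn_realDigamma (Set.mem_Ioi.mpr (by norm_num)) (Set.mem_Ioi.mpr (by linarith))
      (by linarith)
  rw [realDigamma_five_halves] at hψ₁
  rw [realDigamma_two] at hψ₂
  have hlogN : 0 ≤ Real.log N := Real.log_natCast_nonneg N
  have hlog : Real.log ((N : ℝ) * d ^ 2) = Real.log N + 2 * Real.log d := by
    rw [Real.log_mul (by positivity) (by positivity), Real.log_pow]
    norm_num
  have hfact := log_factorial_le_of_five_le hn
  have hlt : 2 * Real.log (2 * π) - realDigamma (k / 2 + t) - realDigamma (k / 2 - t)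
      - 2.6 < 0 := by
    linarith [log_two_mul_pi_lt, eulerMascheroniConstant_lt_d3, Real.log_two_lt_d9]
  have := mul_neg_of_pos_of_neg hn0 hlt
  rw [hlog]
  linarith
end
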